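/- arXiv:2509.02989 — 3 statements merged into one kernel-verified Lean document; each statement's English description precedes it below -/
import Mathlib

section
/- Fermionic anomaly constraint: under hypotheses (H1') and (H2), for all l, g, h, k ∈ G, α(g,h,k) − α(lg,h,k) + α(l,gh,k) − α(l,g,hk) + α(l,g,h) = s(ν(l,g), ν(h,k)) in ℝ/ℤ, i.e. δα = (1/2)ν², where s(x,y) ∈ ℝ/ℤ is the class of 1/2 if x = y = 1 in ℤ/2 and 0 otherwise. -/
noncomputable section

/-- `s(x,y) ∈ ℝ/ℤ` is the class of `1/2` if `x = y = 1` in `ℤ/2`, and `0` otherwise. -/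
def halfPair (x y : ZMod 2) : AddCircle (1 : ℝ) :=
  if x = 1 ∧ y = 1 then (((1 : ℝ) / 2 : ℝ) : AddCircle (1 : ℝ)) else 0

/-- **Fermionic anomaly constraint.** Under (H1') and (H2), with `ν(g,h) := σ(u(g,h))`,
the coboundary of `α` equals `(1/2)ν²`:
`δα(l,g,h,k) = s(ν(l,g), ν(h,k))` in `ℝ/ℤ`. -/
theorem fermionic_anomaly_constraint {G A : Type*} [Group G] [Group A]
    (e : AddCircle (1 : ℝ) → A)
    (he_hom : ∀ s t : AddCircle (1 : ℝ), e (s + t) = e s * e t)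
    (he_inj : Function.Injective e)
    (he_cent : ∀ (t : AddCircle (1 : ℝ)) (a : A), e t * a = a * e t)
    (ρ : G → MulAut A)
    (hρe : ∀ (g : G) (t : AddCircle (1 : ℝ)), ρ g (e t) = e t)
    (σ : A → ZMod 2)
    (hσ_mul : ∀ a b : A, σ (a * b) = σ a + σ b)
    (hσρ : ∀ (g : G) (a : A), σ (ρ g a) = σ a)
    (hσe : ∀ t : AddCircle (1 : ℝ), σ (e t) = 0)
    (u : G → G → A) (α : G → G → G → AddCircle (1 : ℝ))
    (H1' : ∀ (g h : G) (a : A),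
      ρ g (ρ h a) = e (halfPair (σ (u g h)) (σ a)) * u g h * ρ (g * h) a * (u g h)⁻¹)
    (H2 : ∀ g h k : G,
      ρ g (u h k) * u g (h * k) = e (α g h k) * u g h * u (g * h) k) :
    ∀ l g h k : G,
      α g h k - α (l * g) h k + α l (g * h) k - α l g (h * k) + α l g h
        = halfPair (σ (u l g)) (σ (u h k)) := by
  intro l g h k
  have pull : ∀ (a b : A) (t : AddCircle (1 : ℝ)), a * (e t * b) = e t * (a * b) := by
    intro a b t
    rw [← mul_assoc, ← he_cent, mul_assoc]
  have w1 : ρ l (ρ g (u h k) * u g (h * k)) * u l (g * (h * k))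
      = e (α g h k + (α l (g * h) k + α l g h)) * (u l g * (u (l * g) h * u (l * g * h) k)) := by
    have h1 := H2 l (g * h) k
    have h2 := H2 l g h
    simp only [mul_assoc] at h1 h2
    simp only [H2 g h k, map_mul, hρe, he_hom, mul_assoc]
    rw [h1, pull (ρ l (u g h)), ← mul_assoc (ρ l (u g h)), h2]
    simp only [mul_assoc]
  have w2 : ρ l (ρ g (u h k) * u g (h * k)) * u l (g * (h * k))
      = e (halfPair (σ (u l g)) (σ (u h k)) + (α l g (h * k) + α (l * g) h k))
        * (u l g * (u (l * g) h * u (l * g * h) k)) := by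
    have h1 := H2 l g (h * k)
    have h2 := H2 (l * g) h k
    simp only [mul_assoc] at h1 h2
    rw [map_mul, H1']
    simp only [he_hom, mul_assoc]
    rw [h1, pull (u l g)⁻¹, inv_mul_cancel_left, pull (ρ _ _), h2, pull (u l g), pull (u l g)]
  have w := he_inj (mul_right_cancel (w1.symm.trans w2))
  rw [← sub_eq_zero] at w ⊢
  rw [← w]
  abel
end
end

section
/- Equivalence relation for fermionic anomalies: let Σ : G → A be any map and set ξ(g) := σ(Σ(g)) ∈ ℤ/2; define ũ(g,h) := Σ(g)·ρ_g(Σ(h))·u(g,h)·Σ(gh)⁻¹ and ρ̃_g(a) := e(s(ξ(g), σ(a)))·Σ(g)·ρ_g(a)·Σ(g)⁻¹. Then under hypotheses (H1') and (H2), for all g, h, k ∈ G, ρ̃_g(ũ(h,k))·ũ(g,hk) = e( α(g,h,k) + s(ξ(g), ν(h,k)+ξ(h)+ξ(k)+ξ(hk)) + s(ξ(k), ν(g,h)) )·ũ(g,h)·ũ(gh,k), i.e. the redefined fusion operators realize the shifted anomaly phase α̃(g,h,k) = α(g,h,k) + (1/2)(ξ(g)(ν(h,k)+δξ(h,k)) +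 ξ(k)ν(g,h)). -/
noncomputable section

/-- **Equivalence relation for fermionic anomalies.** Redefining the half-space
actions by boundary unitaries `Σ`, with `ξ(g) := σ(Σ(g))`,
`ũ(g,h) := Σ(g)·ρ_g(Σ(h))·u(g,h)·Σ(gh)⁻¹` and
`ρ̃_g(a) := e(s(ξ(g),σ(a)))·Σ(g)·ρ_g(a)·Σ(g)⁻¹`, the redefined fusion operators
realize the shifted anomaly phase
`α̃(g,h,k) = α(g,h,k) + s(ξ(g), ν(h,k)+ξ(h)+ξ(k)+ξ(hk)) + s(ξ(k), ν(g,h))`. -/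
theorem fermionic_anomaly_equivalence {G A : Type*} [Group G] [Group A]
    (e : AddCircle (1 : ℝ) → A)
    (he_hom : ∀ s t : AddCircle (1 : ℝ), e (s + t) = e s * e t)
    (he_inj : Function.Injective e)
    (he_cent : ∀ (t : AddCircle (1 : ℝ)) (a : A), e t * a = a * e t)
    (ρ : G → MulAut A)
    (hρe : ∀ (g : G) (t : AddCircle (1 : ℝ)), ρ g (e t) = e t)
    (σ : A → ZMod 2)
    (hσ_mul : ∀ a b : A, σ (a * b) = σ a + σ b)
    (hσρ : ∀ (g : G) (a : A), σ (ρ g a) = σ a)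
    (hσe : ∀ t : AddCircle (1 : ℝ), σ (e t) = 0)
    (u : G → G → A) (α : G → G → G → AddCircle (1 : ℝ))
    (H1' : ∀ (g h : G) (a : A),
      ρ g (ρ h a) = e (halfPair (σ (u g h)) (σ a)) * u g h * ρ (g * h) a * (u g h)⁻¹)
    (H2 : ∀ g h k : G,
      ρ g (u h k) * u g (h * k) = e (α g h k) * u g h * u (g * h) k)
    (SS : G → A) :
    ∀ g h k : G,
      let ut : G → G → A := fun g h => SS g * ρ g (SS h) * u g h * (SS (g * h))⁻¹
      let ρt : G → A → A := fun g a =>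
        e (halfPair (σ (SS g)) (σ a)) * SS g * ρ g a * (SS g)⁻¹
      ρt g (ut h k) * ut g (h * k)
        = e (α g h k
            + halfPair (σ (SS g)) (σ (u h k) + σ (SS h) + σ (SS k) + σ (SS (h * k)))
            + halfPair (σ (SS k)) (σ (u g h)))
          * ut g h * ut (g * h) k := by
  intro g h k
  have hσinv : ∀ a : A, σ a⁻¹ = σ a := by
    intro a
    have h1 : σ 1 = 0 := by
      have := hσ_mul 1 1
      simpa using this
    have h2 := hσ_mul a a⁻¹
    rw [mul_inv_cancel, h1] at h2
    have h3 : ∀ x y : ZMod 2, 0 = x + y → y = x := by decide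
    exact h3 _ _ h2
  have hs : σ (SS h * ρ h (SS k) * u h k * (SS (h * k))⁻¹)
      = σ (u h k) + σ (SS h) + σ (SS k) + σ (SS (h * k)) := by
    simp only [hσ_mul, hσρ, hσinv]
    ring
  have hsymm : halfPair (σ (SS k)) (σ (u g h)) = halfPair (σ (u g h)) (σ (SS k)) := by
    simp only [halfPair, and_comm]
  simp only [hs, hsymm, he_hom]
  generalize halfPair (σ (SS g)) (σ (u h k) + σ (SS h) + σ (SS k) + σ (SS (h * k))) = p
  have h1 := H1' g h (SS k)
  generalize halfPair (σ (u g h)) (σ (SS k)) = q at h1 ⊢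
  have h2 := H2 g h k
  simp only [map_mul, map_inv, h1, mul_assoc g h k]
  generalize ρ g (SS h) = X
  generalize ρ (g * h) (SS k) = Y
  calc _ = e p * SS g * X * (e q * u g h * Y * (u g h)⁻¹)
          * (ρ g (u h k) * u g (h * k)) * (SS (g * (h * k)))⁻¹ := by group
    _ = e p * (SS g * X * e q) * (u g h * Y * (u g h)⁻¹ * e (α g h k))
          * u g h * u (g * h) k * (SS (g * (h * k)))⁻¹ := by rw [h2]; group
    _ = e p * (e q * (SS g * X)) * (e (α g h k) * (u g h * Y * (u g h)⁻¹))
          * u g h * u (g * h) k * (SS (g * (h * k)))⁻¹ := by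
        rw [he_cent q, he_cent (α g h k)]
    _ = e p * e q * ((SS g * X) * e (α g h k)) * (u g h * Y)
          * u (g * h) k * (SS (g * (h * k)))⁻¹ := by group
    _ = (e p * e q) * e (α g h k) * ((SS g * X)) * (u g h * Y)
          * u (g * h) k * (SS (g * (h * k)))⁻¹ := by
        rw [← he_cent (α g h k)]; group
    _ = _ := by
        rw [← he_cent (α g h k) (e p * e q)]; group
end
end

section
/- Addition formula for fermionic anomalies: under the stated hypotheses on the two systems and on the graded tensor map T, for all g, h, k ∈ G one has T(ρ_g(u(h,k)), ρ'_g(u'(h,k)))·T(u(g,hk), u'(g,hk)) = ê( α(g,h,k) + α'(g,h,k) + s(ν(g,hk), ν'(h,k)) + s(ν(gh,k), ν'(g,h)) )·T(u(g,h), u'(g,h))·T(u(gh,k), u'(gh,k)); that is, the combined system realizes the anomaly phase α̂ = α + α' + (1/2)·(ν ∪₁ ν'), where (ν ∪₁ ν')(g,h,k) = ν(g,hk)ν'(h,k) + ν(gh,k)ν'(g,h). -/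
noncomputable section

theorem halfPair_comm_aux (x y : ZMod 2) : halfPair x y = halfPair y x := by
  unfold halfPair
  simp only [and_comm]

theorem halfPair_self_aux (x y : ZMod 2) : halfPair x y + halfPair x y = 0 := by
  unfold halfPair
  split_ifs
  · rw [← AddCircle.coe_add]
    norm_num
  · simp

theorem halfPair_zero_aux (y : ZMod 2) : halfPair 0 y = 0 := by
  simp [halfPair]

/-- **Addition formula for fermionic anomalies.** Combining two systems via a graded
tensor map `T`, the combined fusion operators realize the anomaly
`α̂ = α + α' + (1/2)(ν ∪₁ ν')`, where
`(ν ∪₁ ν')(g,h,k) = ν(g,hk)ν'(h,k) + ν(gh,k)ν'(g,h)`. -/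
theorem fermionic_anomaly_addition {G A A' Ah : Type*}
    [Group G] [Group A] [Group A'] [Group Ah]
    (e : AddCircle (1 : ℝ) → A)
    (he_hom : ∀ s t : AddCircle (1 : ℝ), e (s + t) = e s * e t)
    (he_cent : ∀ (t : AddCircle (1 : ℝ)) (a : A), e t * a = a * e t)
    (e' : AddCircle (1 : ℝ) → A')
    (he'_hom : ∀ s t : AddCircle (1 : ℝ), e' (s + t) = e' s * e' t)
    (he'_cent : ∀ (t : AddCircle (1 : ℝ)) (a : A'), e' t * a = a * e' t)
    (eh : AddCircle (1 : ℝ) → Ah)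
    (heh_hom : ∀ s t : AddCircle (1 : ℝ), eh (s + t) = eh s * eh t)
    (heh_cent : ∀ (t : AddCircle (1 : ℝ)) (a : Ah), eh t * a = a * eh t)
    (ρ : G → MulAut A) (hρe : ∀ (g : G) (t : AddCircle (1 : ℝ)), ρ g (e t) = e t)
    (ρ' : G → MulAut A') (hρ'e : ∀ (g : G) (t : AddCircle (1 : ℝ)), ρ' g (e' t) = e' t)
    (σ : A → ZMod 2)
    (hσ_mul : ∀ a b : A, σ (a * b) = σ a + σ b)
    (hσe : ∀ t : AddCircle (1 : ℝ), σ (e t) = 0)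
    (hσρ : ∀ (g : G) (a : A), σ (ρ g a) = σ a)
    (σ' : A' → ZMod 2)
    (hσ'_mul : ∀ a b : A', σ' (a * b) = σ' a + σ' b)
    (hσ'e : ∀ t : AddCircle (1 : ℝ), σ' (e' t) = 0)
    (hσ'ρ : ∀ (g : G) (a : A'), σ' (ρ' g a) = σ' a)
    (u : G → G → A) (α : G → G → G → AddCircle (1 : ℝ))
    (H2 : ∀ g h k : G,
      ρ g (u h k) * u g (h * k) = e (α g h k) * u g h * u (g * h) k)
    (u' : G → G → A') (α' : G → G → G → AddCircle (1 : ℝ))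
    (H2' : ∀ g h k : G,
      ρ' g (u' h k) * u' g (h * k) = e' (α' g h k) * u' g h * u' (g * h) k)
    (T : A → A' → Ah)
    (hT_mul : ∀ (a b : A) (a' b' : A'),
      T a a' * T b b' = eh (halfPair (σ' a') (σ b)) * T (a * b) (a' * b'))
    (hT_e : ∀ t : AddCircle (1 : ℝ), T (e t) 1 = eh t)
    (hT_e' : ∀ t : AddCircle (1 : ℝ), T 1 (e' t) = eh t) :
    ∀ g h k : G,
      T (ρ g (u h k)) (ρ' g (u' h k)) * T (u g (h * k)) (u' g (h * k))
        = eh (α g h k + α' g h k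
            + halfPair (σ (u g (h * k))) (σ' (u' h k))
            + halfPair (σ (u (g * h) k)) (σ' (u' g h)))
          * T (u g h) (u' g h) * T (u (g * h) k) (u' (g * h) k) := by
  intro g h k
  have eh0 : eh 0 = 1 := by
    have := heh_hom 0 0
    rw [add_zero] at this
    exact (left_eq_mul.mp this)
  have s1 : σ' 1 = 0 := by
    have := hσ'_mul 1 1
    rw [mul_one] at this
    exact (left_eq_add.mp this)
  have k1 : ∀ t a a', T (e t * a) a' = eh t * T a a' := by
    intro t a a'
    have := hT_mul (e t) a 1 a'
    rw [s1, halfPair_zero_aux, eh0, hT_e, one_mul, one_mul] at this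
    exact this.symm
  have k2 : ∀ t a a', T a (e' t * a') = eh t * T a a' := by
    intro t a a'
    have := hT_mul 1 a (e' t) a'
    rw [hσ'e, halfPair_zero_aux, eh0, hT_e', one_mul, one_mul] at this
    exact this.symm
  rw [hT_mul, H2, H2', hσ'ρ, mul_assoc (e _), mul_assoc (e' _), k1, k2, mul_assoc (eh _) (T _ _),
    hT_mul, ← mul_assoc, ← mul_assoc, ← mul_assoc, ← heh_hom, ← heh_hom, ← heh_hom,
    halfPair_comm_aux (σ (u (g * h) k)), add_assoc _ (halfPair _ _) (halfPair _ _),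
    halfPair_self_aux, add_zero, halfPair_comm_aux (σ (u g (h * k)))]
  congr 2
  abel
end
end
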